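/- arXiv:1703.06821 — 3 statements merged into one kernel-verified Lean document; each statement's English description precedes it below -/
import Mathlib

section
/- Let K be a field and let n, n₁ be natural numbers with 3 ≤ n₁ and 3 ≤ n − n₁ + 1. Let π₁ : K^n → K^{n₁} be the map u ↦ (u_1, …, u_{n₁}) and π₂ : K^n → K^{n−n₁+1} the map u ↦ (u_{n₁}, …, u_n). Let χ₁ be a nonzero alternating trilinear form on K^{n₁} and χ₂ a nonzero alternating trilinear form on K^{n−n₁+1}, and define the alternating trilinear form χ on K^n by χ(x, y, z) := χ₁(π₁x, π₁y, π₁z) + χ₂(π₂x, π₂y, π₂z). Suppose f₁ ∈ K[X_1, …, X_{n₁}] and f₂ ∈ K[X_1, …, X_{n−n₁+1}] are homogeneous polynomials such that a nonzero v ∈ K^{n₁} is a pole of χ₁ if and only if f₁(v) = 0, and a nonzero w ∈ K^{n−n₁+1} is a pole of χ₂ if and only if f₂(w) = 0. Then a nonzero u ∈ K^n is a pole of χ if and only if u_{n₁} · f₁(u_1, …, u_{n₁}) · f₂(u_{n₁}, …, u_n) = 0. -/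
open Module

/-- The radical of a point `u` with respect to an alternating trilinear form `χ` on `V`:
the subspace `Rad_χ(u) = {v ∈ V | χ(u, v, x) = 0 for all x ∈ V}`. -/
def trilinRad {K V : Type*} [Field K] [AddCommGroup V] [Module K V]
    (χ : AlternatingMap K V K (Fin 3)) (u : V) : Submodule K V where
  carrier := {v | ∀ x : V, χ ![u, v, x] = 0}
  add_mem' := by
    intro a b ha hb x
    have h1 : (![u, a + b, x] : Fin 3 → V) = Function.update ![u, a, x] 1 (a + b) := by
      funext i; fin_cases i <;> simp
    have h2 : Function.update (![u, a, x] : Fin 3 → V) 1 a = ![u, a, x] := by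
      funext i; fin_cases i <;> simp
    have h3 : Function.update (![u, a, x] : Fin 3 → V) 1 b = ![u, b, x] := by
      funext i; fin_cases i <;> simp
    calc χ ![u, a + b, x]
        = χ (Function.update ![u, a, x] 1 (a + b)) := by rw [h1]
      _ = χ (Function.update ![u, a, x] 1 a) + χ (Function.update ![u, a, x] 1 b) := by
          rw [AlternatingMap.map_update_add]
      _ = 0 := by rw [h2, h3, ha x, hb x, add_zero]
  zero_mem' := by
    intro x
    exact AlternatingMap.map_coord_zero χ 1 (by simp)
  smul_mem' := by
    intro c a ha x
    have h1 : (![u, c • a, x] : Fin 3 → V) = Function.update ![u, a, x] 1 (c • a) := by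
      funext i; fin_cases i <;> simp
    have h2 : Function.update (![u, a, x] : Fin 3 → V) 1 a = ![u, a, x] := by
      funext i; fin_cases i <;> simp
    rw [h1, AlternatingMap.map_update_smul, h2, ha x, smul_zero]

/-- The basic alternating trilinear form `[ijk]` on `K^n`, sending `(x, y, z)` to the
determinant of the 3×3 matrix with rows `(x i, x j, x k)`, `(y i, y j, y k)`,
`(z i, z j, z k)`.  (Indices are 0-based: the form written `[123]` in the paper is
`trip 0 1 2`.) -/
noncomputable def trip {K : Type*} [Field K] {n : ℕ} (i j k : Fin n) :
    AlternatingMap K (Fin n → K) K (Fin 3) :=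
  (Matrix.detRowAlternating : AlternatingMap K (Fin 3 → K) K (Fin 3)).compLinearMap
    (LinearMap.funLeft K K ![i, j, k])

section Poles

variable {K V V₁ V₂ : Type*} [Field K] [AddCommGroup V] [Module K V]
  [AddCommGroup V₁] [Module K V₁] [AddCommGroup V₂] [Module K V₂]

theorem mem_trilinRad {χ : AlternatingMap K V K (Fin 3)} {u v : V} :
    v ∈ trilinRad χ u ↔ ∀ x, χ ![u, v, x] = 0 := Iff.rfl

theorem self_mem_trilinRad (χ : AlternatingMap K V K (Fin 3)) (u : V) :
    u ∈ trilinRad χ u := fun _ =>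
  χ.map_eq_zero_of_eq _ (i := 0) (j := 1) rfl (by decide)

/-- A nonzero point is a pole iff its radical contains a vector outside its span. -/
theorem two_le_finrank_trilinRad_iff [FiniteDimensional K V]
    (χ : AlternatingMap K V K (Fin 3)) {u : V} (hu : u ≠ 0) :
    2 ≤ finrank K (trilinRad χ u) ↔ ∃ v ∈ trilinRad χ u, ∀ c : K, c • u ≠ v := by
  have h_u : (⟨u, self_mem_trilinRad χ u⟩ : trilinRad χ u) ≠ 0 := by
    simpa [Subtype.ext_iff] using hu
  constructor
  · intro h
    by_contra! hc
    have : finrank K (trilinRad χ u) ≤ 1 :=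
      finrank_le_one ⟨u, self_mem_trilinRad χ u⟩ fun w => by
        obtain ⟨c, hcw⟩ := hc w w.2
        exact ⟨c, Subtype.ext hcw⟩
    omega
  · rintro ⟨v, hv, hvu⟩
    by_contra! hlt
    obtain ⟨c, hc⟩ := (finrank_le_one_iff.1 (Nat.le_of_lt_succ hlt)).elim fun w hw => by
      obtain ⟨c, hc⟩ := hw ⟨u, self_mem_trilinRad χ u⟩
      obtain ⟨d, hd⟩ := hw ⟨v, hv⟩
      have hc0 : c ≠ 0 := by
        rintro rfl
        exact h_u (by rw [← hc, zero_smul])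
      exact (⟨d * c⁻¹, by rw [← hc, ← hd, smul_smul, inv_mul_cancel_right₀ hc0]⟩ :
        ∃ e : K, e • (⟨u, self_mem_trilinRad χ u⟩ : trilinRad χ u) = ⟨v, hv⟩)
    exact hvu c (congrArg Subtype.val hc)

/-- If a functional `l` does not vanish at `u`, then `u` is a pole iff its radical meets
`ker l` nontrivially. -/
theorem two_le_finrank_trilinRad_iff_of_functional [FiniteDimensional K V]
    (χ : AlternatingMap K V K (Fin 3)) {u : V} (l : V →ₗ[K] K) (hl : l u ≠ 0) :
    2 ≤ finrank K (trilinRad χ u) ↔ ∃ v ∈ trilinRad χ u, l v = 0 ∧ v ≠ 0 := by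
  have hu : u ≠ 0 := by
    rintro rfl
    exact hl (map_zero l)
  rw [two_le_finrank_trilinRad_iff χ hu]
  constructor
  · rintro ⟨v, hv, hvu⟩
    refine ⟨v - (l v / l u) • u,
      sub_mem hv (Submodule.smul_mem _ _ (self_mem_trilinRad χ u)), ?_, ?_⟩
    · simp [hl]
    · exact fun h => hvu _ (sub_eq_zero.1 h).symm
  · rintro ⟨v, hv, hlv, hv0⟩
    refine ⟨v, hv, ?_⟩
    rintro c rfl
    simp_all

theorem mem_trilinRad_of_forall_ker {χ : AlternatingMap K V K (Fin 3)} {u v : V}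
    {l : V →ₗ[K] K} (hl : l u ≠ 0) (h : ∀ x, l x = 0 → χ ![u, v, x] = 0) :
    v ∈ trilinRad χ u := by
  intro x
  let φ : V →ₗ[K] K := χ.toMultilinearMap.toLinearMap ![u, v, 0] 2
  have hφ : ∀ y, φ y = χ ![u, v, y] := fun y => by
    refine congrArg χ ?_
    funext i
    fin_cases i <;> simp
  have hx : χ ![u, v, x - (l x / l u) • u] = 0 := h _ (by simp [hl])
  have hu : χ ![u, v, u] = 0 := χ.map_eq_zero_of_eq _ (i := 0) (j := 2) rfl (by decide)
  rw [← hφ] at hx hu ⊢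
  simpa [hu] using hx

theorem mem_trilinRad_add_compLinearMap {χ₁ : AlternatingMap K V₁ K (Fin 3)}
    {χ₂ : AlternatingMap K V₂ K (Fin 3)} {p₁ : V →ₗ[K] V₁} {p₂ : V →ₗ[K] V₂} {u v : V} :
    v ∈ trilinRad (χ₁.compLinearMap p₁ + χ₂.compLinearMap p₂) u ↔
      ∀ x, χ₁ ![p₁ u, p₁ v, p₁ x] + χ₂ ![p₂ u, p₂ v, p₂ x] = 0 := by
  refine forall_congr' fun x => ?_
  have h₁ : (fun i => p₁ (![u, v, x] i)) = ![p₁ u, p₁ v, p₁ x] := by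
    funext i; fin_cases i <;> rfl
  have h₂ : (fun i => p₂ (![u, v, x] i)) = ![p₂ u, p₂ v, p₂ x] := by
    funext i; fin_cases i <;> rfl
  rw [AlternatingMap.add_apply, AlternatingMap.compLinearMap_apply,
    AlternatingMap.compLinearMap_apply, ← h₁, ← h₂]

theorem mem_trilinRad_add_compLinearMap_of_mem {χ₁ : AlternatingMap K V₁ K (Fin 3)}
    {χ₂ : AlternatingMap K V₂ K (Fin 3)} {p₁ : V →ₗ[K] V₁} {p₂ : V →ₗ[K] V₂} {u v : V}
    (h₁ : p₁ v ∈ trilinRad χ₁ (p₁ u)) (h₂ : p₂ v ∈ trilinRad χ₂ (p₂ u)) :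
    v ∈ trilinRad (χ₁.compLinearMap p₁ + χ₂.compLinearMap p₂) u :=
  mem_trilinRad_add_compLinearMap.2 fun x => by rw [h₁, h₂, add_zero]

/-- Poles of a sum of two forms glued along a common coordinate: `V` is the fibre product of
`V₁` and `V₂` over functionals `l₁` and `l₂`. -/
theorem two_le_finrank_trilinRad_add_iff [FiniteDimensional K V] [FiniteDimensional K V₁]
    [FiniteDimensional K V₂] (χ₁ : AlternatingMap K V₁ K (Fin 3))
    (χ₂ : AlternatingMap K V₂ K (Fin 3)) (p₁ : V →ₗ[K] V₁) (p₂ : V →ₗ[K] V₂)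
    (l₁ : V₁ →ₗ[K] K) (l₂ : V₂ →ₗ[K] K) (hl : ∀ v, l₁ (p₁ v) = l₂ (p₂ v))
    (h_inj : ∀ v, p₁ v = 0 → p₂ v = 0 → v = 0)
    (hlift₁ : ∀ a, l₁ a = 0 → ∃ v, p₁ v = a ∧ p₂ v = 0)
    (hlift₂ : ∀ b, l₂ b = 0 → ∃ v, p₁ v = 0 ∧ p₂ v = b)
    (hker₁ : ∃ a, l₁ a = 0 ∧ a ≠ 0) (hker₂ : ∃ b, l₂ b = 0 ∧ b ≠ 0) {u : V} (hu : u ≠ 0) :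
    2 ≤ finrank K (trilinRad (χ₁.compLinearMap p₁ + χ₂.compLinearMap p₂) u) ↔
      l₁ (p₁ u) = 0 ∨ 2 ≤ finrank K (trilinRad χ₁ (p₁ u)) ∨
        2 ≤ finrank K (trilinRad χ₂ (p₂ u)) := by
  by_cases h0 : l₁ (p₁ u) = 0
  · simp only [h0, true_or, iff_true]
    rw [two_le_finrank_trilinRad_iff _ hu]
    by_cases hb : p₂ u = 0
    · obtain ⟨b, hb0, hbne⟩ := hker₂
      obtain ⟨v, hv₁, hv₂⟩ := hlift₂ b hb0
      refine ⟨v, mem_trilinRad_add_compLinearMap_of_mem (hv₁ ▸ zero_mem _) ?_, ?_⟩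
      · intro x
        exact χ₂.map_coord_zero 0 (by simp [hb])
      · rintro c rfl
        exact hbne (by rw [← hv₂, map_smul, hb, smul_zero])
    · obtain ⟨a, ha0, hane, ha⟩ : ∃ a, l₁ a = 0 ∧ a ≠ 0 ∧ a ∈ trilinRad χ₁ (p₁ u) := by
        by_cases ha : p₁ u = 0
        · obtain ⟨a, ha0, hane⟩ := hker₁
          exact ⟨a, ha0, hane, fun x => χ₁.map_coord_zero 0 (by simp [ha])⟩
        · exact ⟨p₁ u, h0, ha, self_mem_trilinRad _ _⟩
      obtain ⟨v, hv₁, hv₂⟩ := hlift₁ a ha0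
      refine ⟨v, mem_trilinRad_add_compLinearMap_of_mem (hv₁.symm ▸ ha)
        (hv₂ ▸ zero_mem _), ?_⟩
      rintro c rfl
      rw [map_smul, smul_eq_zero_iff_left hb] at hv₂
      exact hane (by rw [← hv₁, hv₂, zero_smul, map_zero])
  · have h0' : l₂ (p₂ u) ≠ 0 := hl u ▸ h0
    rw [two_le_finrank_trilinRad_iff_of_functional _ (l₁ ∘ₗ p₁) h0,
      two_le_finrank_trilinRad_iff_of_functional χ₁ l₁ h0,
      two_le_finrank_trilinRad_iff_of_functional χ₂ l₂ h0']
    simp only [h0, false_or]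
    constructor
    · rintro ⟨v, hv, hlv, hv0⟩
      rw [mem_trilinRad_add_compLinearMap] at hv
      have hm₁ : p₁ v ∈ trilinRad χ₁ (p₁ u) := mem_trilinRad_of_forall_ker h0 fun x hx => by
        obtain ⟨y, rfl, hy₂⟩ := hlift₁ x hx
        have hz : χ₂ ![p₂ u, p₂ v, 0] = 0 := χ₂.map_coord_zero 2 rfl
        simpa [hy₂, hz] using hv y
      have hm₂ : p₂ v ∈ trilinRad χ₂ (p₂ u) := mem_trilinRad_of_forall_ker h0' fun x hx => by
        obtain ⟨y, hy₁, rfl⟩ := hlift₂ x hx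
        have hz : χ₁ ![p₁ u, p₁ v, 0] = 0 := χ₁.map_coord_zero 2 rfl
        simpa [hy₁, hz] using hv y
      by_cases hp : p₁ v = 0
      · exact Or.inr ⟨p₂ v, hm₂, hl v ▸ hlv, fun h => hv0 (h_inj v hp h)⟩
      · exact Or.inl ⟨p₁ v, hm₁, hlv, hp⟩
    · rintro (⟨a, ha, hla, ha0⟩ | ⟨b, hb, hlb, hb0⟩)
      · obtain ⟨v, rfl, hv₂⟩ := hlift₁ a hla
        exact ⟨v, mem_trilinRad_add_compLinearMap_of_mem ha (hv₂ ▸ zero_mem _), hla,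
          fun h => ha0 (by rw [h, map_zero])⟩
      · obtain ⟨v, hv₁, rfl⟩ := hlift₂ b hlb
        exact ⟨v, mem_trilinRad_add_compLinearMap_of_mem (hv₁ ▸ zero_mem _) hb,
          (hl v).trans hlb, fun h => hb0 (by rw [h, map_zero])⟩

end Poles

/-- if `χ` on `K^n` is the sum of forms pulled back from the first `n₁`
coordinates and from the last `n - n₁ + 1` coordinates (overlapping in coordinate `n₁`),
and the poles of the two pieces are cut out by homogeneous polynomials `f₁`, `f₂`, then
the poles of `χ` are cut out by `u_{n₁} · f₁(u_1,…,u_{n₁}) · f₂(u_{n₁},…,u_n)`. -/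
theorem stmt3 (K : Type*) [Field K] (n n₁ : ℕ) (h₁ : 3 ≤ n₁) (h₂ : 3 ≤ n - n₁ + 1)
    (χ₁ : AlternatingMap K (Fin n₁ → K) K (Fin 3)) (hχ₁ : χ₁ ≠ 0)
    (χ₂ : AlternatingMap K (Fin (n - n₁ + 1) → K) K (Fin 3)) (hχ₂ : χ₂ ≠ 0)
    (f₁ : MvPolynomial (Fin n₁) K) (f₂ : MvPolynomial (Fin (n - n₁ + 1)) K)
    (hf₁ : ∃ d, f₁.IsHomogeneous d) (hf₂ : ∃ d, f₂.IsHomogeneous d)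
    (hp₁ : ∀ v : Fin n₁ → K, v ≠ 0 →
      (2 ≤ Module.finrank K (trilinRad χ₁ v) ↔ MvPolynomial.eval v f₁ = 0))
    (hp₂ : ∀ w : Fin (n - n₁ + 1) → K, w ≠ 0 →
      (2 ≤ Module.finrank K (trilinRad χ₂ w) ↔ MvPolynomial.eval w f₂ = 0)) :
    ∀ u : Fin n → K, u ≠ 0 →
      (2 ≤ Module.finrank K (trilinRad
          (χ₁.compLinearMap
              (LinearMap.funLeft K K (fun i : Fin n₁ => (⟨(i : ℕ), by omega⟩ : Fin n))) +
            χ₂.compLinearMap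
              (LinearMap.funLeft K K (fun i : Fin (n - n₁ + 1) =>
                (⟨n₁ - 1 + (i : ℕ), by have := i.isLt; omega⟩ : Fin n)))) u) ↔
        u (⟨n₁ - 1, by omega⟩ : Fin n) *
            MvPolynomial.eval (fun i : Fin n₁ => u (⟨(i : ℕ), by omega⟩ : Fin n)) f₁ *
            MvPolynomial.eval (fun i : Fin (n - n₁ + 1) =>
              u (⟨n₁ - 1 + (i : ℕ), by have := i.isLt; omega⟩ : Fin n)) f₂ = 0) := by
  intro u hu
  let p₁ : (Fin n → K) →ₗ[K] (Fin n₁ → K) :=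
    LinearMap.funLeft K K (fun i : Fin n₁ => (⟨(i : ℕ), by omega⟩ : Fin n))
  let p₂ : (Fin n → K) →ₗ[K] (Fin (n - n₁ + 1) → K) :=
    LinearMap.funLeft K K (fun i : Fin (n - n₁ + 1) =>
      (⟨n₁ - 1 + (i : ℕ), by have := i.isLt; omega⟩ : Fin n))
  let l₁ : (Fin n₁ → K) →ₗ[K] K := LinearMap.proj ⟨n₁ - 1, by omega⟩
  let l₂ : (Fin (n - n₁ + 1) → K) →ₗ[K] K := LinearMap.proj ⟨0, by omega⟩
  have key := two_le_finrank_trilinRad_add_iff χ₁ χ₂ p₁ p₂ l₁ l₂ (fun _ => rfl) ?_ ?_ ?_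
    ⟨Pi.single ⟨0, by omega⟩ 1, ?_, by simp⟩
    ⟨Pi.single ⟨n - n₁, by omega⟩ 1, ?_, by simp⟩ hu
  · refine key.trans ?_
    rw [mul_eq_zero, mul_eq_zero, or_assoc]
    by_cases h0 : l₁ (p₁ u) = 0
    · exact iff_of_true (Or.inl h0) (Or.inl h0)
    · have ha : p₁ u ≠ 0 := fun h => h0 (by rw [h, map_zero])
      have hb : p₂ u ≠ 0 := fun h => h0 (show l₂ (p₂ u) = 0 by rw [h, map_zero])
      exact or_congr Iff.rfl (or_congr (hp₁ _ ha) (hp₂ _ hb))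
  · intro v hv₁ hv₂
    funext ⟨i, hi⟩
    by_cases hin : i < n₁
    · exact congrFun hv₁ ⟨i, hin⟩
    · have h := congrFun hv₂ ⟨i - (n₁ - 1), by omega⟩
      have he : n₁ - 1 + (i - (n₁ - 1)) = i := by omega
      simpa [p₂, LinearMap.funLeft_apply, he] using h
  · intro a ha
    refine ⟨fun i => if h : (i : ℕ) < n₁ then a ⟨i, h⟩ else 0, ?_, ?_⟩
    · funext i
      simp [p₁, LinearMap.funLeft_apply]
    · funext i
      simp only [p₂, LinearMap.funLeft_apply, Pi.zero_apply]
      split_ifs with h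
      · have he : (⟨n₁ - 1 + (i : ℕ), h⟩ : Fin n₁) = ⟨n₁ - 1, by omega⟩ :=
          Fin.ext (by simp only; omega)
        rw [he]
        exact ha
      · rfl
  · intro b hb
    refine ⟨fun i => if h : n₁ - 1 ≤ (i : ℕ) then b ⟨i - (n₁ - 1), by omega⟩ else 0, ?_, ?_⟩
    · funext i
      simp only [p₁, LinearMap.funLeft_apply, Pi.zero_apply]
      split_ifs with h
      · have he : (⟨(i : ℕ) - (n₁ - 1), by omega⟩ : Fin (n - n₁ + 1)) = ⟨0, by omega⟩ :=
          Fin.ext (by simp only; omega)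
        rw [he]
        exact hb
      · rfl
    · funext i
      exact (dif_pos (Nat.le_add_right _ _)).trans (congrArg b (Fin.ext (by simp)))
  · exact Pi.single_eq_of_ne (by simp only [ne_eq, Fin.mk.injEq]; omega) _
  · exact Pi.single_eq_of_ne (by simp only [ne_eq, Fin.mk.injEq]; omega) _
end

section
/- Let K be a field and let V₀, V₁ be finite-dimensional K-vector spaces of dimensions n₀ ≥ 3 and n₁ ≥ 3. Let χ₀, χ₁ be nonzero alternating trilinear forms on V₀ and V₁ respectively, define χ on V := V₀ × V₁ by χ((x₀,x₁), (y₀,y₁), (z₀,z₁)) := χ₀(x₀, y₀, z₀) + χ₁(x₁, y₁, z₁), and let π₀ : V → V₀ and π₁ : V → V₁ be the coordinate projections. Then a 2-dimensional subspace ℓ of V lies in the upper radical R↑(χ) if and only if both of the following hold: (dim π₀(ℓ) < 2 or π₀(ℓ) ∈ R↑(χ₀)) and (dim π₁(ℓ) < 2 or π₁(ℓ) ∈ R↑(χ₁)); equivalently, if and only if χ₀(u₀, π₀x, π₀y) = 0 for all u₀ ∈ V₀ and all x, y ∈ ℓ, and χ₁(u₁, π₁x, π₁y) = 0 for all u₁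 ∈ V₁ and all x, y ∈ ℓ. -/
open Module

/-- The block decomposable alternating trilinear form on `V₀ × V₁` defined by
`χ((x₀,x₁),(y₀,y₁),(z₀,z₁)) = χ₀(x₀,y₀,z₀) + χ₁(x₁,y₁,z₁)`. -/
noncomputable def blockForm {K V₀ V₁ : Type*} [Field K]
    [AddCommGroup V₀] [Module K V₀] [AddCommGroup V₁] [Module K V₁]
    (χ₀ : AlternatingMap K V₀ K (Fin 3)) (χ₁ : AlternatingMap K V₁ K (Fin 3)) :
    AlternatingMap K (V₀ × V₁) K (Fin 3) :=
  χ₀.compLinearMap (LinearMap.fst K V₀ V₁) + χ₁.compLinearMap (LinearMap.snd K V₀ V₁)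

/-- An alternating trilinear form vanishes as soon as two of its arguments lie in a common
subspace of dimension less than two. -/
theorem AlternatingMap.apply_eq_zero_of_finrank_lt_two {K V : Type*} [Field K] [AddCommGroup V]
    [Module K V] [FiniteDimensional K V] (χ : AlternatingMap K V K (Fin 3)) {W : Submodule K V}
    (hW : Module.finrank K W < 2) (u : V) {x y : V} (hx : x ∈ W) (hy : y ∈ W) :
    χ ![u, x, y] = 0 := by
  refine χ.map_linearDependent _ fun hli => ?_
  have hxy : LinearIndependent K ![(⟨x, hx⟩ : W), ⟨y, hy⟩] := by
    refine LinearIndependent.of_comp W.subtype ?_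
    have hcomp : W.subtype ∘ ![(⟨x, hx⟩ : W), ⟨y, hy⟩] = ![u, x, y] ∘ Fin.succ := by
      funext i
      fin_cases i <;> rfl
    rw [hcomp]
    exact hli.comp Fin.succ (Fin.succ_injective 2)
  have hcard := hxy.fintype_card_le_finrank
  rw [Fintype.card_fin] at hcard
  omega

/-- A subspace of dimension at most two either has dimension less than two or is a
two-dimensional subspace in the upper radical of `χ` if and only if `χ` vanishes whenever two of
its arguments lie in it. -/
theorem AlternatingMap.finrank_lt_two_or_iff {K V : Type*} [Field K] [AddCommGroup V]
    [Module K V] [FiniteDimensional K V] (χ : AlternatingMap K V K (Fin 3)) (W : Submodule K V)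
    (hW : Module.finrank K W ≤ 2) :
    (Module.finrank K W < 2 ∨
        (Module.finrank K W = 2 ∧ ∀ u : V, ∀ x ∈ W, ∀ y ∈ W, χ ![u, x, y] = 0)) ↔
      ∀ u : V, ∀ x ∈ W, ∀ y ∈ W, χ ![u, x, y] = 0 := by
  constructor
  · rintro (h | ⟨-, h⟩)
    · exact fun u x hx y hy => χ.apply_eq_zero_of_finrank_lt_two h u hx hy
    · exact h
  · intro h
    exact (lt_or_eq_of_le hW).imp_right fun h2 => ⟨h2, h⟩

theorem blockForm_apply {K V₀ V₁ : Type*} [Field K]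
    [AddCommGroup V₀] [Module K V₀] [AddCommGroup V₁] [Module K V₁]
    (χ₀ : AlternatingMap K V₀ K (Fin 3)) (χ₁ : AlternatingMap K V₁ K (Fin 3))
    (u x y : V₀ × V₁) :
    blockForm χ₀ χ₁ ![u, x, y] = χ₀ ![u.1, x.1, y.1] + χ₁ ![u.2, x.2, y.2] := by
  simp only [blockForm, AlternatingMap.add_apply, AlternatingMap.compLinearMap_apply]
  congr 2 <;> funext i <;> fin_cases i <;> rfl

/-- A subspace is totally isotropic for all contractions of a block decomposable form if and only
if its two projections are so for the two blocks. -/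
theorem blockForm_eq_zero_iff {K V₀ V₁ : Type*} [Field K]
    [AddCommGroup V₀] [Module K V₀] [AddCommGroup V₁] [Module K V₁]
    (χ₀ : AlternatingMap K V₀ K (Fin 3)) (χ₁ : AlternatingMap K V₁ K (Fin 3))
    (ℓ : Submodule K (V₀ × V₁)) :
    (∀ u : V₀ × V₁, ∀ x ∈ ℓ, ∀ y ∈ ℓ, blockForm χ₀ χ₁ ![u, x, y] = 0) ↔
      (∀ u₀ : V₀, ∀ x ∈ ℓ, ∀ y ∈ ℓ, χ₀ ![u₀, x.1, y.1] = 0) ∧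
        (∀ u₁ : V₁, ∀ x ∈ ℓ, ∀ y ∈ ℓ, χ₁ ![u₁, x.2, y.2] = 0) := by
  simp only [blockForm_apply]
  constructor
  · refine fun h => ⟨fun u x hx y hy => ?_, fun u x hx y hy => ?_⟩
    · have h0 : χ₁ ![0, x.2, y.2] = 0 := χ₁.map_coord_zero 0 rfl
      simpa [h0] using h (u, 0) x hx y hy
    · have h0 : χ₀ ![0, x.1, y.1] = 0 := χ₀.map_coord_zero 0 rfl
      simpa [h0] using h (0, u) x hx y hy
  · rintro ⟨h₀, h₁⟩ u x hx y hy
    rw [h₀ _ x hx y hy, h₁ _ x hx y hy, add_zero]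

/-- characterization of the 2-dimensional subspaces of `V₀ × V₁` lying in
the upper radical of a block decomposable form, both in terms of the projections of `ℓ`
and explicitly. -/
theorem stmt6 (K V₀ V₁ : Type*) [Field K]
    [AddCommGroup V₀] [Module K V₀] [AddCommGroup V₁] [Module K V₁]
    [FiniteDimensional K V₀] [FiniteDimensional K V₁]
    (h₀ : 3 ≤ Module.finrank K V₀) (h₁ : 3 ≤ Module.finrank K V₁)
    (χ₀ : AlternatingMap K V₀ K (Fin 3)) (hχ₀ : χ₀ ≠ 0)
    (χ₁ : AlternatingMap K V₁ K (Fin 3)) (hχ₁ : χ₁ ≠ 0)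
    (ℓ : Submodule K (V₀ × V₁)) (hℓ : Module.finrank K ℓ = 2) :
    ((∀ u : V₀ × V₁, ∀ x ∈ ℓ, ∀ y ∈ ℓ, blockForm χ₀ χ₁ ![u, x, y] = 0) ↔
      ((Module.finrank K (ℓ.map (LinearMap.fst K V₀ V₁)) < 2 ∨
          (Module.finrank K (ℓ.map (LinearMap.fst K V₀ V₁)) = 2 ∧
            ∀ u₀ : V₀, ∀ x₀ ∈ ℓ.map (LinearMap.fst K V₀ V₁),
              ∀ y₀ ∈ ℓ.map (LinearMap.fst K V₀ V₁), χ₀ ![u₀, x₀, y₀] = 0)) ∧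
        (Module.finrank K (ℓ.map (LinearMap.snd K V₀ V₁)) < 2 ∨
          (Module.finrank K (ℓ.map (LinearMap.snd K V₀ V₁)) = 2 ∧
            ∀ u₁ : V₁, ∀ x₁ ∈ ℓ.map (LinearMap.snd K V₀ V₁),
              ∀ y₁ ∈ ℓ.map (LinearMap.snd K V₀ V₁), χ₁ ![u₁, x₁, y₁] = 0)))) ∧
    ((∀ u : V₀ × V₁, ∀ x ∈ ℓ, ∀ y ∈ ℓ, blockForm χ₀ χ₁ ![u, x, y] = 0) ↔
      ((∀ u₀ : V₀, ∀ x ∈ ℓ, ∀ y ∈ ℓ, χ₀ ![u₀, (x : V₀ × V₁).1, (y : V₀ × V₁).1] = 0) ∧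
        (∀ u₁ : V₁, ∀ x ∈ ℓ, ∀ y ∈ ℓ, χ₁ ![u₁, (x : V₀ × V₁).2, (y : V₀ × V₁).2] = 0))) := by
  refine ⟨?_, blockForm_eq_zero_iff χ₀ χ₁ ℓ⟩
  rw [AlternatingMap.finrank_lt_two_or_iff χ₀ _ ((Submodule.finrank_map_le _ ℓ).trans hℓ.le),
    AlternatingMap.finrank_lt_two_or_iff χ₁ _ ((Submodule.finrank_map_le _ ℓ).trans hℓ.le),
    blockForm_eq_zero_iff]
  simp only [Submodule.mem_map, forall_exists_index, and_imp, forall_apply_eq_imp_iff₂,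
    LinearMap.fst_apply, LinearMap.snd_apply]
end

section
/- Let K be a field, V = K^6, χ := [123] + [456], V₀ := span(e_1, e_2, e_3) and V₁ := span(e_4, e_5, e_6). Then every nonzero u ∈ V is a pole of χ, and a 2-dimensional subspace ℓ of V lies in the upper radical R↑(χ) if and only if ℓ = span{x, y} for some nonzero x ∈ V₀ and nonzero y ∈ V₁. -/
open Module

section UpperRadical

variable {K : Type*} [Field K]

lemma trip_apply {n : ℕ} (i j k : Fin n) (x y z : Fin n → K) :
    trip i j k ![x, y, z] =
      x i * (y j * z k - y k * z j) - x j * (y i * z k - y k * z i)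
        + x k * (y i * z j - y j * z i) := by
  have h : trip i j k ![x, y, z] =
      Matrix.det (Matrix.of fun a b : Fin 3 ↦ (![x, y, z] : Fin 3 → Fin n → K) a (![i, j, k] b)) :=
    rfl
  rw [h, Matrix.det_fin_three]
  simp
  ring

lemma mem_span_single_triple {i j k : Fin 6} (x : Fin 6 → K)
    (h : ∀ l, l ≠ i → l ≠ j → l ≠ k → x l = 0) (hij : i ≠ j) (hik : i ≠ k) (hjk : j ≠ k) :
    x ∈ Submodule.span K
      ({Pi.single i 1, Pi.single j 1, Pi.single k 1} : Set (Fin 6 → K)) := by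
  rw [Submodule.mem_span_triple]
  refine ⟨x i, x j, x k, ?_⟩
  ext l
  simp only [Pi.add_apply, Pi.smul_apply, Pi.single_apply, smul_eq_mul]
  by_cases hi : l = i
  · subst hi; simp [hij, hik]
  by_cases hj : l = j
  · subst hj; simp [hi, hjk]
  by_cases hk : l = k
  · subst hk; simp [hi, hj]
  simp [hi, hj, hk, h l hi hj hk]

lemma mem_span_single_zero_one_two {x : Fin 6 → K} :
    x ∈ Submodule.span K
      ({Pi.single 0 1, Pi.single 1 1, Pi.single 2 1} : Set (Fin 6 → K)) ↔
      x 3 = 0 ∧ x 4 = 0 ∧ x 5 = 0 := by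
  constructor
  · rw [Submodule.mem_span_triple]
    rintro ⟨a, b, c, rfl⟩
    simp
  · rintro ⟨h3, h4, h5⟩
    refine mem_span_single_triple x (fun l ↦ ?_) (by decide) (by decide) (by decide)
    fin_cases l <;> simp [h3, h4, h5]

lemma mem_span_single_three_four_five {x : Fin 6 → K} :
    x ∈ Submodule.span K
      ({Pi.single 3 1, Pi.single 4 1, Pi.single 5 1} : Set (Fin 6 → K)) ↔
      x 0 = 0 ∧ x 1 = 0 ∧ x 2 = 0 := by
  constructor
  · rw [Submodule.mem_span_triple]
    rintro ⟨a, b, c, rfl⟩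
    simp
  · rintro ⟨h3, h4, h5⟩
    refine mem_span_single_triple x (fun l ↦ ?_) (by decide) (by decide) (by decide)
    fin_cases l <;> simp [h3, h4, h5]

lemma linearIndependent_pair_of_disjoint_support {ι : Type*} {x y : ι → K}
    (hx : x ≠ 0) (hy : y ≠ 0) (h : ∀ i, x i = 0 ∨ y i = 0) :
    LinearIndependent K ![x, y] := by
  rw [LinearIndependent.pair_iff]
  intro s t hst
  obtain ⟨i, hi⟩ := Function.ne_iff.1 hx
  obtain ⟨j, hj⟩ := Function.ne_iff.1 hy
  simp only [Pi.zero_apply] at hi hj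
  have h1 := congrFun hst i
  have h2 := congrFun hst j
  simp only [Pi.add_apply, Pi.smul_apply, smul_eq_mul, Pi.zero_apply] at h1 h2
  constructor
  · simpa [(h i).resolve_left hi, hi] using h1
  · simpa [(h j).resolve_right hj, hj] using h2

lemma finrank_span_pair {V : Type*} [AddCommGroup V] [Module K V] {x y : V}
    (h : LinearIndependent K ![x, y]) :
    Module.finrank K (Submodule.span K ({x, y} : Set V)) = 2 := by
  rw [← Matrix.range_cons_cons_empty x y ![], finrank_span_eq_card h, Fintype.card_fin]

lemma exists_mem_ne_zero_of_minors_eq_zero {ι κ : Type*} (s : κ → ι)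
    {ℓ : Submodule K (ι → K)} (hℓ : Module.finrank K ℓ = 2)
    (h : ∀ x ∈ ℓ, ∀ y ∈ ℓ, ∀ i j, x (s i) * y (s j) = x (s j) * y (s i)) :
    ∃ z ∈ ℓ, z ≠ 0 ∧ ∀ i, z (s i) = 0 := by
  by_cases h0 : ∃ x ∈ ℓ, ∃ i, x (s i) ≠ 0
  · obtain ⟨x, hx, i, hi⟩ := h0
    have hlt : ¬ ℓ ≤ Submodule.span K {x} := fun hle ↦ by
      have h1 := Submodule.finrank_mono hle
      have h2 := finrank_span_le_card (R := K) ({x} : Set (ι → K))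
      simp only [Set.toFinset_singleton, Finset.card_singleton] at h2
      omega
    obtain ⟨y, hy, hyx⟩ := SetLike.not_le_iff_exists.1 hlt
    refine ⟨x (s i) • y - y (s i) • x,
      ℓ.sub_mem (ℓ.smul_mem _ hy) (ℓ.smul_mem _ hx), fun hz ↦ hyx ?_, fun j ↦ ?_⟩
    · rw [← Submodule.smul_mem_iff _ hi, sub_eq_zero.1 hz]
      exact Submodule.smul_mem _ _ (Submodule.mem_span_singleton_self x)
    · have := h x hx y hy i j
      simp only [Pi.sub_apply, Pi.smul_apply, smul_eq_mul]
      linear_combination this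
  · push Not at h0
    have hne : ℓ ≠ ⊥ := by
      rintro rfl
      simp at hℓ
    obtain ⟨z, hz, hz0⟩ := Submodule.exists_mem_ne_zero_of_ne_bot hne
    exact ⟨z, hz, hz0, h0 z hz⟩

lemma exists_proportional_ne_zero {x e : Fin 6 → K} (he : e ≠ 0) (s : Set (Fin 6))
    (hes : ∀ i ∉ s, e i = 0) :
    ∃ z : Fin 6 → K, z ≠ 0 ∧ (∀ i ∉ s, z i = 0) ∧
      ∀ i ∈ s, ∀ j ∈ s, x i * z j = x j * z i := by
  classical
  by_cases h : ∃ i ∈ s, x i ≠ 0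
  · obtain ⟨i, hi, hxi⟩ := h
    refine ⟨fun j ↦ if j ∈ s then x j else 0, fun hz ↦ hxi ?_, fun j hj ↦ by simp [hj],
      fun j hj k hk ↦ by simp [hj, hk, mul_comm]⟩
    simpa [hi] using congrFun hz i
  · push Not at h
    exact ⟨e, he, hes, fun i hi j hj ↦ by simp [h i hi, h j hj]⟩

lemma two_le_finrank_trilinRad_trip_add_trip (u : Fin 6 → K) :
    2 ≤ Module.finrank K (trilinRad (trip 0 1 2 + trip 3 4 5) u) := by
  obtain ⟨z, hz0, hz, hzu⟩ := exists_proportional_ne_zero (x := u)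
    (e := Pi.single 0 1) (by simp) {0, 1, 2} (by intro i hi; simp_all)
  obtain ⟨w, hw0, hw, hwu⟩ := exists_proportional_ne_zero (x := u)
    (e := Pi.single 3 1) (by simp) {3, 4, 5} (by intro i hi; simp_all)
  have hli := linearIndependent_pair_of_disjoint_support hz0 hw0 fun i ↦ by
    by_cases hi : i ∈ ({0, 1, 2} : Set (Fin 6))
    · refine Or.inr (hw i ?_)
      revert hi
      fin_cases i <;> simp
    · exact Or.inl (hz i hi)
  rw [← finrank_span_pair hli]
  refine Submodule.finrank_mono (Submodule.span_le.2 ?_)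
  rintro v (rfl | rfl) y
  · have h01 := hzu 0 (by simp) 1 (by simp)
    have h02 := hzu 0 (by simp) 2 (by simp)
    have h12 := hzu 1 (by simp) 2 (by simp)
    simp only [AlternatingMap.add_apply, trip_apply, hz 3 (by simp), hz 4 (by simp),
      hz 5 (by simp)]
    linear_combination y 2 * h01 - y 1 * h02 + y 0 * h12
  · have h34 := hwu 3 (by simp) 4 (by simp)
    have h35 := hwu 3 (by simp) 5 (by simp)
    have h45 := hwu 4 (by simp) 5 (by simp)
    simp only [AlternatingMap.add_apply, trip_apply, hw 0 (by simp), hw 1 (by simp),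
      hw 2 (by simp)]
    linear_combination y 5 * h34 - y 4 * h35 + y 3 * h45

end UpperRadical

/-- for `χ = [123] + [456]` on `K^6`, `V₀ = span(e₁,e₂,e₃)` and
`V₁ = span(e₄,e₅,e₆)`, every nonzero vector is a pole and a 2-dimensional subspace is in
the upper radical iff it is spanned by a nonzero vector of `V₀` and a nonzero vector of
`V₁`. -/
theorem stmt10 (K : Type*) [Field K]
    (χ : AlternatingMap K (Fin 6 → K) K (Fin 3))
    (hχ : χ = trip 0 1 2 + trip 3 4 5)
    (V₀ V₁ : Submodule K (Fin 6 → K))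
    (hV₀ : V₀ = Submodule.span K
      ({Pi.single 0 1, Pi.single 1 1, Pi.single 2 1} : Set (Fin 6 → K)))
    (hV₁ : V₁ = Submodule.span K
      ({Pi.single 3 1, Pi.single 4 1, Pi.single 5 1} : Set (Fin 6 → K))) :
    (∀ u : Fin 6 → K, u ≠ 0 → 2 ≤ Module.finrank K (trilinRad χ u)) ∧
    (∀ ℓ : Submodule K (Fin 6 → K), Module.finrank K ℓ = 2 →
      ((∀ u : Fin 6 → K, ∀ x ∈ ℓ, ∀ y ∈ ℓ, χ ![u, x, y] = 0) ↔
        (∃ x ∈ V₀, ∃ y ∈ V₁, x ≠ 0 ∧ y ≠ 0 ∧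
          ℓ = Submodule.span K ({x, y} : Set (Fin 6 → K))))) := by
  subst hχ hV₀ hV₁
  refine ⟨fun u _ ↦ two_le_finrank_trilinRad_trip_add_trip u, fun ℓ hℓ ↦ ⟨fun h ↦ ?_, ?_⟩⟩
  · simp only [AlternatingMap.add_apply, trip_apply] at h
    obtain ⟨y, hy, hy0, hyV⟩ := exists_mem_ne_zero_of_minors_eq_zero
      (![0, 1, 2] : Fin 3 → Fin 6) hℓ fun x hx y hy i j ↦ by
        have h0 := h (Pi.single 0 1) x hx y hy
        have h1 := h (Pi.single 1 1) x hx y hy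
        have h2 := h (Pi.single 2 1) x hx y hy
        simp at h0 h1 h2
        fin_cases i <;> fin_cases j <;> simp <;> grind
    obtain ⟨x, hx, hx0, hxV⟩ := exists_mem_ne_zero_of_minors_eq_zero
      (![3, 4, 5] : Fin 3 → Fin 6) hℓ fun x hx y hy i j ↦ by
        have h0 := h (Pi.single 3 1) x hx y hy
        have h1 := h (Pi.single 4 1) x hx y hy
        have h2 := h (Pi.single 5 1) x hx y hy
        simp at h0 h1 h2
        fin_cases i <;> fin_cases j <;> simp <;> grind
    have hyV' : y 0 = 0 ∧ y 1 = 0 ∧ y 2 = 0 := ⟨hyV 0, hyV 1, hyV 2⟩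
    have hxV' : x 3 = 0 ∧ x 4 = 0 ∧ x 5 = 0 := ⟨hxV 0, hxV 1, hxV 2⟩
    refine ⟨x, mem_span_single_zero_one_two.2 hxV', y,
      mem_span_single_three_four_five.2 hyV', hx0, hy0, ?_⟩
    have hli := linearIndependent_pair_of_disjoint_support hx0 hy0 fun i ↦ by
      fin_cases i <;> simp [hxV', hyV']
    refine (Submodule.eq_of_le_of_finrank_eq (Submodule.span_le.2 ?_) ?_).symm
    · rintro v (rfl | rfl) <;> assumption
    · rw [finrank_span_pair hli, hℓ]
  · rintro ⟨x, hx, y, hy, -, -, rfl⟩ u v hv w hw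
    obtain ⟨hx3, hx4, hx5⟩ := mem_span_single_zero_one_two.1 hx
    obtain ⟨hy0, hy1, hy2⟩ := mem_span_single_three_four_five.1 hy
    obtain ⟨a, b, rfl⟩ := Submodule.mem_span_pair.1 hv
    obtain ⟨c, d, rfl⟩ := Submodule.mem_span_pair.1 hw
    simp only [AlternatingMap.add_apply, trip_apply, Pi.add_apply, Pi.smul_apply, smul_eq_mul,
      hx3, hx4, hx5, hy0, hy1, hy2]
    ring
end
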